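/- arXiv:2601.19327 — 3 statements merged into one kernel-verified Lean document; each statement's English description precedes it below -/
import Mathlib

section
/- Define U(x) = log(x)·log(1-x)/h(x) for 0 < x < 1, where h is the binary entropy function. If x, y ∈ (0,1) and U(x) = U(y), then y = x or y = 1 - x. -/
/-- The binary entropy function `h(x) = -x log x - (1-x) log (1-x)`. -/
noncomputable def binEntropy (x : ℝ) : ℝ :=
  -(x * Real.log x) - (1 - x) * Real.log (1 - x)

/-- A strictly concave function has a larger sum at an inner symmetric pair than at an outer one. -/
theorem StrictConcaveOn.add_lt_add_of_symm {s : Set ℝ} {f : ℝ → ℝ} (hf : StrictConcaveOn ℝ s f)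
    {c x y : ℝ} (hx : x ∈ s) (hcx : c - x ∈ s) (hxy : x < y) (hyx : y < c - x) :
    f x + f (c - x) < f y + f (c - y) := by
  have hd : 0 < c - x - x := by linarith
  have ha : 0 < (c - x - y) / (c - x - x) := div_pos (by linarith) hd
  have hb : 0 < (y - x) / (c - x - x) := div_pos (by linarith) hd
  have hab : (c - x - y) / (c - x - x) + (y - x) / (c - x - x) = 1 := by
    rw [← add_div, div_eq_one_iff_eq hd.ne']
    ring
  have hne : x ≠ c - x := by linarith
  have h₁ := hf.2 hx hcx hne ha hb hab
  have h₂ := hf.2 hx hcx hne hb ha (by rw [add_comm, hab])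
  have e₁ : (c - x - y) / (c - x - x) * x + (y - x) / (c - x - x) * (c - x) = y := by
    field_simp
    ring
  have e₂ : (y - x) / (c - x - x) * x + (c - x - y) / (c - x - x) * (c - x) = c - y := by
    field_simp
    ring
  simp only [smul_eq_mul, e₁, e₂] at h₁ h₂
  linear_combination h₁ + h₂ - (f x + f (c - x)) * hab

/-- For strictly concave `f`, the map `x ↦ f x + f (1 - x)` on `(0, 1)` takes each value only at
a symmetric pair. -/
theorem StrictConcaveOn.eq_or_eq_one_sub {f : ℝ → ℝ}
    (hf : StrictConcaveOn ℝ (Set.Ioo 0 1) f) {x y : ℝ}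
    (hx : x ∈ Set.Ioo (0 : ℝ) 1) (hy : y ∈ Set.Ioo (0 : ℝ) 1)
    (h : f x + f (1 - x) = f y + f (1 - y)) : y = x ∨ y = 1 - x := by
  have key : ∀ u v : ℝ, u ∈ Set.Ioo (0 : ℝ) 1 → u < v → v < 1 - u →
      f u + f (1 - u) < f v + f (1 - v) := fun u v hu =>
    hf.add_lt_add_of_symm hu ⟨by linarith [hu.2], by linarith [hu.1]⟩
  have hx' : 1 - x ∈ Set.Ioo (0 : ℝ) 1 := ⟨by linarith [hx.2], by linarith [hx.1]⟩
  have hy' : 1 - y ∈ Set.Ioo (0 : ℝ) 1 := ⟨by linarith [hy.2], by linarith [hy.1]⟩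
  by_contra! hne
  rcases lt_or_gt_of_ne hne.1 with h₁ | h₁ <;> rcases lt_or_gt_of_ne hne.2 with h₂ | h₂
  · linarith [key y x hy h₁ (by linarith)]
  · have := key (1 - x) y hx' h₂ (by linarith)
    rw [sub_sub_cancel] at this
    linarith
  · linarith [key x y hx h₁ h₂]
  · have := key (1 - y) x hy' (by linarith) (by linarith)
    rw [sub_sub_cancel] at this
    linarith

/-- The logarithmic mean of `t` and `1` is strictly concave in `t`, since it equals
`∫ s in 0..1, t ^ s`. -/
theorem strictConcaveOn_sub_one_div_log :
    StrictConcaveOn ℝ (Set.Ioo 0 1) fun t : ℝ => (t - 1) / Real.log t := by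
  refine ⟨convex_Ioo 0 1, fun x hx y hy hxy a b ha hb hab => ?_⟩
  have hz := convex_Ioo (0 : ℝ) 1 hx hy ha.le hb.le hab
  simp only [smul_eq_mul] at hz ⊢
  set z := a * x + b * y with hzdef
  have hderiv : ∀ t ∈ Set.Ioo (0 : ℝ) 1, ∀ s : ℝ,
      HasDerivAt (fun s : ℝ => t ^ s / Real.log t) (t ^ s) s := fun t ht s => by
    have := (Real.hasStrictDerivAt_const_rpow ht.1 s).hasDerivAt.div_const (Real.log t)
    rwa [mul_div_cancel_right₀ _ (Real.log_neg ht.1 ht.2).ne] at this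
  have hG : ∀ s : ℝ, HasDerivAt
      (fun s : ℝ => z ^ s / Real.log z - (a * (x ^ s / Real.log x) + b * (y ^ s / Real.log y)))
      (z ^ s - (a * x ^ s + b * y ^ s)) s := fun s =>
    (hderiv z hz s).sub (((hderiv x hx s).const_mul a).add ((hderiv y hy s).const_mul b))
  have hmono := strictMonoOn_of_deriv_pos (convex_Icc (0 : ℝ) 1)
    (fun s _ => (hG s).continuousAt.continuousWithinAt) fun s hs => by
      rw [interior_Icc] at hs
      rw [(hG s).deriv, sub_pos]
      exact (Real.strictConcaveOn_rpow hs.1 hs.2).2 hx.1.le hy.1.le hxy ha hb hab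
  have h := hmono (Set.left_mem_Icc.2 zero_le_one) (Set.right_mem_Icc.2 zero_le_one) zero_lt_one
  simp only [Real.rpow_zero, Real.rpow_one] at h
  simp only [sub_div]
  linarith

theorem inv_log_mul_log_div_binEntropy {x : ℝ} (hx : x ∈ Set.Ioo (0 : ℝ) 1) :
    (Real.log x * Real.log (1 - x) / binEntropy x)⁻¹ =
      (x - 1) / Real.log x + (1 - x - 1) / Real.log (1 - x) := by
  have h₁ := (Real.log_neg hx.1 hx.2).ne
  have h₂ := (Real.log_neg (sub_pos.2 hx.2) (by linarith [hx.1])).ne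
  rw [inv_div, binEntropy]
  field_simp
  ring

/-- If `U(x) = U(y)` for `x, y ∈ (0,1)`, where
`U(x) = log(x) log(1-x) / h(x)`, then `y = x` or `y = 1 - x`. -/
theorem U_eq_iff (x y : ℝ) (hx : x ∈ Set.Ioo (0 : ℝ) 1) (hy : y ∈ Set.Ioo (0 : ℝ) 1)
    (hU : Real.log x * Real.log (1 - x) / binEntropy x =
      Real.log y * Real.log (1 - y) / binEntropy y) :
    y = x ∨ y = 1 - x := by
  refine strictConcaveOn_sub_one_div_log.eq_or_eq_one_sub hx hy ?_
  simp only [← inv_log_mul_log_div_binEntropy hx, ← inv_log_mul_log_div_binEntropy hy, hU]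
end

section
/- For 0 < t < 1, the logarithmic mean L(1,t) = -(1-t)/log t equals the integral ∫₀¹ t^s ds, and the function t ↦ L(1,t) is strictly concave on (0,1). -/
lemma integral_const_rpow_zero_one {t : ℝ} (ht : 0 < t) (ht1 : t ≠ 1) :
    ∫ s in (0 : ℝ)..1, t ^ s = -(1 - t) / Real.log t := by
  have hlog : Real.log t ≠ 0 := Real.log_ne_zero_of_pos_of_ne_one ht ht1
  have hderiv : ∀ s ∈ Set.uIcc (0 : ℝ) 1,
      HasDerivAt (fun s : ℝ => t ^ s / Real.log t) (t ^ s) s := fun s _ => by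
    have h := (Real.hasStrictDerivAt_const_rpow ht s).hasDerivAt.div_const (Real.log t)
    rwa [mul_div_cancel_right₀ _ hlog] at h
  rw [intervalIntegral.integral_eq_sub_of_hasDerivAt hderiv
    ((Real.continuous_const_rpow ht.ne').intervalIntegrable _ _)]
  rw [Real.rpow_one, Real.rpow_zero]
  ring

lemma strictConcaveOn_integral_rpow :
    StrictConcaveOn ℝ (Set.Ioi (0 : ℝ)) fun t => ∫ s in (0 : ℝ)..1, t ^ s := by
  refine ⟨convex_Ioi 0, fun x hx y hy hxy a b ha hb hab => ?_⟩
  have hx' : 0 < x := hx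
  have hy' : 0 < y := hy
  have hz : 0 < a * x + b * y := by positivity
  have hcx := Real.continuous_const_rpow hx'.ne'
  have hcy := Real.continuous_const_rpow hy'.ne'
  simp only [smul_eq_mul]
  rw [← intervalIntegral.integral_const_mul, ← intervalIntegral.integral_const_mul,
    ← intervalIntegral.integral_add ((hcx.const_mul a).intervalIntegrable _ _)
      ((hcy.const_mul b).intervalIntegrable _ _)]
  refine intervalIntegral.integral_lt_integral_of_continuousOn_of_le_of_exists_lt zero_lt_one
    ((hcx.const_mul a).add (hcy.const_mul b)).continuousOn
    (Real.continuous_const_rpow hz.ne').continuousOn (fun s hs => ?_) ⟨1 / 2, by norm_num, ?_⟩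
  · exact (Real.concaveOn_rpow hs.1.le hs.2).2 hx'.le hy'.le ha.le hb.le hab
  · exact (Real.strictConcaveOn_rpow (by norm_num) (by norm_num)).2 hx'.le hy'.le hxy ha hb hab

/-- For `0 < t < 1`, the logarithmic mean `L(1,t) = -(1-t)/log t` equals
`∫ s in [0,1], t ^ s`, and `t ↦ L(1,t)` is strictly concave on `(0,1)`. -/
theorem logMean_eq_integral_and_strictConcave :
    (∀ t ∈ Set.Ioo (0 : ℝ) 1,
        -(1 - t) / Real.log t = ∫ s in (0 : ℝ)..1, t ^ s) ∧
      StrictConcaveOn ℝ (Set.Ioo (0 : ℝ) 1)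
        (fun t : ℝ => -(1 - t) / Real.log t) := by
  have heq : ∀ t ∈ Set.Ioo (0 : ℝ) 1,
      -(1 - t) / Real.log t = ∫ s in (0 : ℝ)..1, t ^ s := fun t ht =>
    (integral_const_rpow_zero_one ht.1 ht.2.ne).symm
  exact ⟨heq, (strictConcaveOn_integral_rpow.subset Set.Ioo_subset_Ioi_self
    (convex_Ioo 0 1)).congr fun t ht => (heq t ht).symm⟩
end

section
/- Let k > 1 be real, let α_k be the unique positive solution to x(1+x)^{k-1} = 1, and let q(x) = x^{k-1} h(x) / h(x^k) for 0 < x < 1, where h is the binary entropy function. Then for x in (0,1), the derivative q'(x) = 0 if and only if x = 1/(1+α_k). -/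
theorem binEntropy_eq_real_binEntropy : binEntropy = Real.binEntropy := by
  funext x
  simp only [binEntropy, Real.binEntropy, Real.log_inv]
  ring

theorem binEntropy_pos {x : ℝ} (hx : x ∈ Set.Ioo (0 : ℝ) 1) : 0 < binEntropy x := by
  rw [binEntropy_eq_real_binEntropy]
  exact Real.binEntropy_pos hx.1 hx.2

theorem hasDerivAt_binEntropy {x : ℝ} (hx : x ∈ Set.Ioo (0 : ℝ) 1) :
    HasDerivAt binEntropy (Real.log (1 - x) - Real.log x) x := by
  rw [binEntropy_eq_real_binEntropy]
  exact Real.hasDerivAt_binEntropy hx.1.ne' hx.2.ne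

/-- The logarithmic mean of `t` and `1`. -/
noncomputable def logMean (t : ℝ) : ℝ := (t - 1) / Real.log t

theorem integral_rpow_exponent {t : ℝ} (ht : t ∈ Set.Ioo (0 : ℝ) 1) :
    ∫ s in (0 : ℝ)..1, t ^ s = logMean t := by
  have hlog : Real.log t ≠ 0 := (Real.log_neg ht.1 ht.2).ne
  have hderiv (s : ℝ) : HasDerivAt (fun s : ℝ => t ^ s / Real.log t) (t ^ s) s := by
    have h := ((hasDerivAt_id s).const_rpow ht.1).div_const (Real.log t)
    refine h.congr_deriv ?_
    rw [mul_one, mul_div_cancel_left₀ _ hlog, id]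
  have hcont : Continuous fun s : ℝ => t ^ s := Real.continuous_const_rpow ht.1.ne'
  rw [intervalIntegral.integral_eq_sub_of_hasDerivAt (fun s _ => hderiv s)
    (hcont.intervalIntegrable 0 1), Real.rpow_one, Real.rpow_zero, logMean]
  ring

theorem strictConcaveOn_logMean : StrictConcaveOn ℝ (Set.Ioo 0 1) logMean := by
  refine ⟨convex_Ioo 0 1, fun x hx y hy hxy a b ha hb hab => ?_⟩
  have hz : a • x + b • y ∈ Set.Ioo (0 : ℝ) 1 := convex_Ioo 0 1 hx hy ha.le hb.le hab
  have hcont {t : ℝ} (ht : t ∈ Set.Ioo (0 : ℝ) 1) : Continuous fun s : ℝ => t ^ s :=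
    Real.continuous_const_rpow ht.1.ne'
  have hcomb : Continuous fun s : ℝ => a • x ^ s + b • y ^ s :=
    ((hcont hx).const_smul a).add ((hcont hy).const_smul b)
  rw [← integral_rpow_exponent hx, ← integral_rpow_exponent hy, ← integral_rpow_exponent hz,
    ← intervalIntegral.integral_smul, ← intervalIntegral.integral_smul,
    ← intervalIntegral.integral_add
      (Continuous.intervalIntegrable (u := fun s : ℝ => a • x ^ s) ((hcont hx).const_smul a) 0 1)
      (Continuous.intervalIntegrable (u := fun s : ℝ => b • y ^ s) ((hcont hy).const_smul b) 0 1)]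
  refine intervalIntegral.integral_lt_integral_of_continuousOn_of_le_of_exists_lt zero_lt_one
    hcomb.continuousOn (hcont hz).continuousOn (fun s hs => ?_)
    ⟨1 / 2, by norm_num, ?_⟩
  · exact (Real.concaveOn_rpow hs.1.le hs.2).2 hx.1.le hy.1.le ha.le hb.le hab
  · exact (Real.strictConcaveOn_rpow (by norm_num) (by norm_num)).2 hx.1.le hy.1.le hxy ha hb hab

theorem logMean_add_logMean_one_sub_lt {x y : ℝ} (hx : x ∈ Set.Ioo (0 : ℝ) 1)
    (hxy : |y - 1 / 2| < |x - 1 / 2|) :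
    logMean x + logMean (1 - x) < logMean y + logMean (1 - y) := by
  have hx' : 1 - x ∈ Set.Ioo (0 : ℝ) 1 := ⟨by linarith [hx.2], by linarith [hx.1]⟩
  have hne : x - (1 - x) ≠ 0 := by
    intro h
    rw [show x - 1 / 2 = 0 by linarith, abs_zero] at hxy
    exact absurd hxy (abs_nonneg _).not_gt
  obtain ⟨a, b, ha, hb, hab, rfl⟩ : ∃ a b : ℝ, 0 < a ∧ 0 < b ∧ a + b = 1 ∧
      a • x + b • (1 - x) = y := by
    have hr : |(y - 1 / 2) / (x - 1 / 2)| < 1 := by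
      rw [abs_div, div_lt_one ((abs_nonneg _).trans_lt hxy)]
      exact hxy
    obtain ⟨h₁, h₂⟩ := abs_lt.mp hr
    refine ⟨(1 + (y - 1 / 2) / (x - 1 / 2)) / 2, (1 - (y - 1 / 2) / (x - 1 / 2)) / 2,
      by linarith, by linarith, by ring, ?_⟩
    have hne' : x - 1 / 2 ≠ 0 := fun h => hne (by linarith)
    have hmul := div_mul_cancel₀ (y - 1 / 2) hne'
    simp only [smul_eq_mul]
    linear_combination hmul
  have h₁ := strictConcaveOn_logMean.2 hx hx' (sub_ne_zero.mp hne) ha hb hab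
  have h₂ := strictConcaveOn_logMean.2 hx' hx (sub_ne_zero.mp hne).symm ha hb hab
  have hrefl : 1 - (a • x + b • (1 - x)) = a • (1 - x) + b • x := by
    simp only [smul_eq_mul]
    linear_combination -hab
  rw [hrefl]
  simp only [smul_eq_mul] at h₁ h₂ ⊢
  have hsum : (a * logMean x + b * logMean (1 - x)) + (a * logMean (1 - x) + b * logMean x) =
      logMean x + logMean (1 - x) := by
    linear_combination (logMean x + logMean (1 - x)) * hab
  linarith

theorem logMean_add_logMean_one_sub_eq_iff {x y : ℝ} (hx : x ∈ Set.Ioo (0 : ℝ) 1)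
    (hy : y ∈ Set.Ioo (0 : ℝ) 1) :
    logMean x + logMean (1 - x) = logMean y + logMean (1 - y) ↔ y = x ∨ y = 1 - x := by
  constructor
  · intro h
    rcases lt_trichotomy |y - 1 / 2| |x - 1 / 2| with hlt | heq | hgt
    · exact absurd h (logMean_add_logMean_one_sub_lt hx hlt).ne
    · rcases abs_eq_abs.mp heq with h | h
      · exact Or.inl (by linarith)
      · exact Or.inr (by linarith)
    · exact absurd h.symm (logMean_add_logMean_one_sub_lt hy hgt).ne
  · rintro (rfl | rfl)
    · rfl
    · rw [sub_sub_cancel, add_comm]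

theorem binEntropy_eq_log_mul_log_mul {x : ℝ} (hx : x ∈ Set.Ioo (0 : ℝ) 1) :
    binEntropy x =
      Real.log x * Real.log (1 - x) * (logMean x + logMean (1 - x)) := by
  have h₁ : Real.log x ≠ 0 := (Real.log_neg hx.1 hx.2).ne
  have h₂ : Real.log (1 - x) ≠ 0 :=
    (Real.log_neg (by linarith [hx.2]) (by linarith [hx.1])).ne
  simp only [binEntropy, logMean]
  field_simp
  ring

theorem one_sub_eq_rpow_iff {k α x : ℝ} (hk : 1 < k) (hα : 0 < α)
    (hαeq : α * (1 + α) ^ (k - 1) = 1) (hx : 0 < x) :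
    x ^ k = 1 - x ↔ x = 1 / (1 + α) := by
  have hpos : 0 < 1 + α := by linarith
  have hroot : (1 / (1 + α)) ^ k = 1 - 1 / (1 + α) := by
    rw [Real.rpow_sub_one hpos.ne'] at hαeq
    rw [Real.div_rpow zero_le_one hpos.le, Real.one_rpow]
    have := Real.rpow_pos_of_pos hpos k
    field_simp at hαeq ⊢
    linarith
  refine ⟨fun h => ?_, fun h => h ▸ hroot⟩
  rcases lt_trichotomy x (1 / (1 + α)) with hlt | heq | hgt
  · have := Real.rpow_lt_rpow hx.le hlt (zero_lt_one.trans hk)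
    linarith
  · exact heq
  · have := Real.rpow_lt_rpow (by positivity) hgt (zero_lt_one.trans hk)
    linarith

theorem hasDerivAt_rpow_mul_binEntropy_div {k x : ℝ} (hk : 0 < k)
    (hx : x ∈ Set.Ioo (0 : ℝ) 1) :
    HasDerivAt (fun x : ℝ => x ^ (k - 1) * binEntropy x / binEntropy (x ^ k))
      (x ^ (k - 1) / (x * binEntropy (x ^ k) ^ 2) *
        (Real.log (1 - x) * binEntropy (x ^ k) - k * binEntropy x * Real.log (1 - x ^ k))) x := by
  have hy : x ^ k ∈ Set.Ioo (0 : ℝ) 1 :=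
    ⟨Real.rpow_pos_of_pos hx.1 k, Real.rpow_lt_one hx.1.le hx.2 hk⟩
  have hden := (binEntropy_pos hy).ne'
  have hx₀ := hx.1.ne'
  have h := ((Real.hasDerivAt_rpow_const (p := k - 1) (Or.inl hx₀)).mul
    (hasDerivAt_binEntropy hx)).div
    (HasDerivAt.comp x (h₂ := binEntropy) (hasDerivAt_binEntropy hy)
      (Real.hasDerivAt_rpow_const (p := k) (Or.inl hx₀))) (by exact hden)
  refine h.congr_deriv ?_
  have hp : x ^ k = x ^ (k - 1) * x := by
    rw [Real.rpow_sub_one hx₀, div_mul_cancel₀ _ hx₀]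
  have hentx : x * Real.log x = -binEntropy x - (1 - x) * Real.log (1 - x) := by
    rw [binEntropy]; ring
  have henty : x ^ k * Real.log (x ^ k) =
      -binEntropy (x ^ k) - (1 - x ^ k) * Real.log (1 - x ^ k) := by
    rw [binEntropy]; ring
  rw [Real.rpow_sub_one hx₀ (k - 1)]
  simp only [Function.comp_apply, Pi.mul_apply]
  rw [div_mul_eq_mul_div, div_eq_div_iff (by positivity) (by positivity)]
  generalize binEntropy (x ^ k) = hY at *
  generalize binEntropy x = hX at *
  generalize Real.log (x ^ k) = lY at *
  generalize Real.log (1 - x ^ k) = mY at *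
  generalize Real.log x = lX at *
  generalize Real.log (1 - x) = mX at *
  generalize x ^ k = y at *
  generalize x ^ (k - 1) = p at *
  field_simp
  subst hp
  linear_combination -(p * hY) * hentx + (k * p * hX) * henty

/-- For `k > 1` and `α = α_k` the unique positive solution of
`x (1+x)^(k-1) = 1`, with `q(x) = x^(k-1) h(x) / h(x^k)` on `(0,1)`,
the derivative `q'(x)` vanishes iff `x = 1/(1+α)`. -/
theorem deriv_q_eq_zero_iff (k α : ℝ) (hk : 1 < k)
    (hα : 0 < α) (hαeq : α * (1 + α) ^ (k - 1) = 1) :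
    ∀ x ∈ Set.Ioo (0 : ℝ) 1,
      (deriv (fun x : ℝ => x ^ (k - 1) * binEntropy x / binEntropy (x ^ k)) x = 0 ↔
        x = 1 / (1 + α)) := by
  intro x hx
  have hk₀ : 0 < k := zero_lt_one.trans hk
  have hy : x ^ k ∈ Set.Ioo (0 : ℝ) 1 :=
    ⟨Real.rpow_pos_of_pos hx.1 k, Real.rpow_lt_one hx.1.le hx.2 hk₀⟩
  have hyx : x ^ k < x := by
    simpa using Real.rpow_lt_rpow_of_exponent_gt hx.1 hx.2 hk
  have hfactor : x ^ (k - 1) / (x * binEntropy (x ^ k) ^ 2) ≠ 0 :=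
    (div_pos (Real.rpow_pos_of_pos hx.1 _)
      (mul_pos hx.1 (pow_pos (binEntropy_pos hy) 2))).ne'
  have hlog : k * Real.log x * Real.log (1 - x) * Real.log (1 - x ^ k) ≠ 0 :=
    mul_ne_zero (mul_ne_zero (mul_ne_zero hk₀.ne' (Real.log_neg hx.1 hx.2).ne)
      (Real.log_neg (by linarith [hx.2]) (by linarith [hx.1])).ne)
      (Real.log_neg (by linarith [hy.2]) (by linarith [hy.1])).ne
  have hnum : Real.log (1 - x) * binEntropy (x ^ k) - k * binEntropy x * Real.log (1 - x ^ k) =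
      k * Real.log x * Real.log (1 - x) * Real.log (1 - x ^ k) *
        ((logMean (x ^ k) + logMean (1 - x ^ k)) - (logMean x + logMean (1 - x))) := by
    rw [binEntropy_eq_log_mul_log_mul hx, binEntropy_eq_log_mul_log_mul hy, Real.log_rpow hx.1]
    ring
  rw [(hasDerivAt_rpow_mul_binEntropy_div hk₀ hx).deriv, mul_eq_zero, or_iff_right hfactor, hnum,
    mul_eq_zero, or_iff_right hlog, sub_eq_zero, eq_comm,
    logMean_add_logMean_one_sub_eq_iff hx hy, or_iff_right hyx.ne,
    one_sub_eq_rpow_iff hk hα hαeq hx.1]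
end
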